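/- arXiv:2403.06579 — 15 statements merged into one kernel-verified Lean document; each statement's English description precedes it below -/
import Mathlib

section
/- Let a ≥ 0 be a real number. The function f(x, y) = (1/y)·log(1 + 1/(x − a)) is convex on the set {(x, y) ∈ ℝ² : x > a and y > 0}. -/
lemma aux_amgm (p q : ℝ) (hp : 0 < p) (hq : 0 < q) : 3 - p - q ≤ 1 / (p * q) := by
  have hpq : 0 < p * q := mul_pos hp hq
  rw [le_div_iff₀ hpq]
  by_cases h : 3 ≤ p + q
  · nlinarith
  · have h1 : p * q ≤ (p + q) ^ 2 / 4 := by nlinarith [sq_nonneg (p - q)]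
    have h2 : 0 ≤ (p + q - 2) ^ 2 * (p + q + 1) := by positivity
    have h3 := mul_le_mul_of_nonneg_left h1 (by linarith : 0 ≤ 3 - p - q)
    nlinarith

lemma aux_tan (v y V Y : ℝ) (hv : 0 < v) (hy : 0 < y) (hV : 0 < V) (hY : 0 < Y) :
    1 / (V * Y) * (3 - v / V - y / Y) ≤ 1 / y * (1 / v) := by
  have h := aux_amgm (v / V) (y / Y) (by positivity) (by positivity)
  have h' := mul_le_mul_of_nonneg_left h (by positivity : 0 ≤ 1 / (V * Y))
  refine h'.trans (le_of_eq ?_)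
  field_simp

lemma aux_conv (v y w z α β : ℝ) (hv : 0 < v) (hy : 0 < y) (hw : 0 < w) (hz : 0 < z)
    (hα : 0 ≤ α) (hβ : 0 ≤ β) (hs : α + β = 1)
    (hV : 0 < α * v + β * w) (hY : 0 < α * y + β * z) :
    1 / (α * y + β * z) * (1 / (α * v + β * w))
      ≤ α * (1 / y * (1 / v)) + β * (1 / z * (1 / w)) := by
  have h1 := mul_le_mul_of_nonneg_left (aux_tan v y _ _ hv hy hV hY) hα
  have h2 := mul_le_mul_of_nonneg_left (aux_tan w z _ _ hw hz hV hY) hβ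
  refine le_trans (le_of_eq ?_) (add_le_add h1 h2)
  obtain ⟨V, hVe⟩ : ∃ V, V = α * v + β * w := ⟨_, rfl⟩
  obtain ⟨Y, hYe⟩ : ∃ Y, Y = α * y + β * z := ⟨_, rfl⟩
  rw [← hVe] at hV ⊢
  rw [← hYe] at hY ⊢
  have e1 : α * (v / V) + β * (w / V) = 1 := by
    field_simp; linarith
  have e2 : α * (y / Y) + β * (z / Y) = 1 := by
    field_simp; linarith
  have e3 : 1 / Y * (1 / V) = 1 / (V * Y) := by field_simp
  rw [e3]
  linear_combination (1 / (V * Y)) * (e1 + e2 - 3 * hs)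

lemma aux_int (u : ℝ) (hu : 0 < u) :
    Real.log (1 + 1 / u) = ∫ t in (0:ℝ)..1, 1 / (u + t) := by
  rw [intervalIntegral.integral_comp_add_left (fun s => 1 / s) u,
    integral_one_div_of_pos (by linarith) (by linarith)]
  congr 1
  field_simp
  ring

lemma aux_ii (u c : ℝ) (hu : 0 < u) :
    IntervalIntegrable (fun t => c * (1 / (u + t))) MeasureTheory.volume 0 1 := by
  apply ContinuousOn.intervalIntegrable
  intro t ht
  rw [Set.uIcc_of_le zero_le_one] at ht
  have : u + t ≠ 0 := by linarith [ht.1]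
  apply ContinuousAt.continuousWithinAt
  fun_prop (disch := assumption)

theorem stmt_0 (a : ℝ) (ha : 0 ≤ a) :
    ConvexOn ℝ {p : ℝ × ℝ | a < p.1 ∧ 0 < p.2}
      (fun p : ℝ × ℝ => (1 / p.2) * Real.log (1 + 1 / (p.1 - a))) := by
  have hc : Convex ℝ {p : ℝ × ℝ | a < p.1 ∧ 0 < p.2} :=
    (convex_Ioi a).prod (convex_Ioi (0:ℝ))
  refine ⟨hc, ?_⟩
  rintro ⟨x, y⟩ h1 ⟨x', z⟩ h2 α β hα hβ hs
  have h3 := hc h1 h2 hα hβ hs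
  simp only [Set.mem_setOf_eq, Prod.smul_mk, Prod.mk_add_mk, smul_eq_mul] at h1 h2 h3 ⊢
  obtain ⟨hx, hy⟩ := h1
  obtain ⟨hx', hz⟩ := h2
  obtain ⟨hX, hY⟩ := h3
  rw [aux_int _ (sub_pos.2 hx), aux_int _ (sub_pos.2 hx'), aux_int _ (sub_pos.2 hX)]
  simp only [← intervalIntegral.integral_const_mul]
  have i1 := aux_ii _ (1 / y) (sub_pos.2 hx)
  have i2 := aux_ii _ (1 / z) (sub_pos.2 hx')
  rw [← intervalIntegral.integral_add (i1.const_mul α) (i2.const_mul β)]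
  apply intervalIntegral.integral_mono_on zero_le_one (aux_ii _ _ (sub_pos.2 hX))
    ((i1.const_mul α).add (i2.const_mul β))
  intro t ht
  have e : α * x + β * x' - a + t = α * (x - a + t) + β * (x' - a + t) := by
    linear_combination (a - t) * hs
  have hpos : 0 < α * x + β * x' - a + t := by linarith [ht.1]
  rw [e] at hpos ⊢
  exact aux_conv _ _ _ _ _ _ (by linarith [ht.1]) hy (by linarith [ht.1]) hz hα hβ hs hpos hY
end

section
/- Let a ≥ 0 be a real number. The function g(y, z) = a + 1/(exp(y·z) − 1) is convex on the set {(y, z) ∈ ℝ² : y > 0 and z > 0}. -/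
theorem aux_pos (s : ℝ) : 0 < Real.exp (Real.exp s) - 1 := by
  have := Real.one_lt_exp_iff.2 (Real.exp_pos s)
  linarith

theorem aux_deriv (s : ℝ) : HasDerivAt (fun s : ℝ => 1 / (Real.exp (Real.exp s) - 1))
    (-(Real.exp s / (Real.exp (Real.exp s) + Real.exp (-Real.exp s) - 2))) s := by
  have h0 := aux_pos s
  have h1 : HasDerivAt (fun s : ℝ => Real.exp (Real.exp s) - 1)
      (Real.exp (Real.exp s) * Real.exp s) s :=
    ((Real.hasDerivAt_exp s).exp).sub_const 1
  have h2 := h1.inv h0.ne'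
  have h3 : (fun s : ℝ => 1 / (Real.exp (Real.exp s) - 1))
      = (fun s : ℝ => Real.exp (Real.exp s) - 1)⁻¹ := by
    funext x; simp
  rw [h3]
  refine h2.congr_deriv ?_
  rw [Real.exp_neg (Real.exp s)]
  have hE := Real.exp_pos (Real.exp s)
  generalize Real.exp (Real.exp s) = E at *
  have : E + E⁻¹ - 2 = (E - 1) ^ 2 / E := by field_simp; ring
  rw [this]
  field_simp

theorem aux_c (t : ℝ) (ht : 0 < t) : 0 < Real.exp t + Real.exp (-t) - 2 := by
  have h := Real.add_one_lt_exp ht.ne'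
  have h' := Real.add_one_lt_exp (neg_ne_zero.2 ht.ne')
  linarith

theorem aux_cvx (c a b : ℝ) (ha : 0 < a) (hab : a ≤ b) :
    b * (Real.exp (c * a) - 1) ≤ a * (Real.exp (c * b) - 1) := by
  have hb : 0 < b := ha.trans_le hab
  have h := convexOn_exp.2 (Set.mem_univ (c * b)) (Set.mem_univ 0)
    (div_nonneg ha.le hb.le) (sub_nonneg.2 ((div_le_one hb).2 hab)) (by ring)
  simp only [smul_eq_mul, mul_zero, add_zero, Real.exp_zero, mul_one] at h
  have e : a / b * (c * b) = c * a := by field_simp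
  rw [e] at h
  have := mul_le_mul_of_nonneg_left h hb.le
  have e2 : b * (a / b * Real.exp (c * b) + (1 - a / b)) = a * Real.exp (c * b) + (b - a) := by
    field_simp
  linarith

theorem aux_h_convex : ConvexOn ℝ Set.univ (fun s : ℝ => 1 / (Real.exp (Real.exp s) - 1)) := by
  apply Monotone.convexOn_univ_of_deriv
  · exact fun s => (aux_deriv s).differentiableAt
  · intro s t hst
    rw [(aux_deriv s).deriv, (aux_deriv t).deriv]
    have ha := Real.exp_pos s
    have hab := Real.exp_le_exp.2 hst
    have hb := Real.exp_pos t
    apply neg_le_neg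
    rw [div_le_div_iff₀ (aux_c _ hb) (aux_c _ ha)]
    have h1 := aux_cvx 1 _ _ ha hab
    have h2 := aux_cvx (-1) _ _ ha hab
    simp only [one_mul, neg_mul] at h1 h2
    linarith

theorem aux_h_anti {s t : ℝ} (h : s ≤ t) :
    1 / (Real.exp (Real.exp t) - 1) ≤ 1 / (Real.exp (Real.exp s) - 1) := by
  apply one_div_le_one_div_of_le (aux_pos s)
  have := Real.exp_le_exp.2 (Real.exp_le_exp.2 h)
  linarith

theorem stmt_2 (a : ℝ) (ha : 0 ≤ a) :
    ConvexOn ℝ {p : ℝ × ℝ | 0 < p.1 ∧ 0 < p.2}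
      (fun p : ℝ × ℝ => a + 1 / (Real.exp (p.1 * p.2) - 1)) := by
  have hS : Convex ℝ {p : ℝ × ℝ | 0 < p.1 ∧ 0 < p.2} :=
    (convex_Ioi (0:ℝ)).prod (convex_Ioi (0:ℝ))
  refine ⟨hS, ?_⟩
  rintro ⟨y, z⟩ hp ⟨y', z'⟩ hq u v hu hv huv
  have hr := hS hp hq hu hv huv
  obtain ⟨hy, hz⟩ := hp
  obtain ⟨hy', hz'⟩ := hq
  obtain ⟨hY, hZ⟩ := hr
  have key : ∀ y z : ℝ, 0 < y → 0 < z → y * z = Real.exp (Real.log y + Real.log z) := by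
    intro y z hy hz
    rw [Real.exp_add, Real.exp_log hy, Real.exp_log hz]
  have l1 := strictConcaveOn_log_Ioi.concaveOn.2 hy hy' hu hv huv
  have l2 := strictConcaveOn_log_Ioi.concaveOn.2 hz hz' hu hv huv
  simp only [Prod.smul_mk, Prod.mk_add_mk, smul_eq_mul] at *
  rw [key y z hy hz, key y' z' hy' hz', key _ _ hY hZ]
  have c := aux_h_convex.2 (Set.mem_univ (Real.log y + Real.log z))
    (Set.mem_univ (Real.log y' + Real.log z')) hu hv huv
  simp only [smul_eq_mul] at c
  have m := aux_h_anti (s := u * (Real.log y + Real.log z) + v * (Real.log y' + Real.log z'))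
    (t := Real.log (u * y + v * y') + Real.log (u * z + v * z')) (by linarith)
  have e : u * a + v * a = a := by rw [← add_mul, huv, one_mul]
  linarith
end

section
/- For all reals y > 0 and z > 0, writing E = exp(y·z), the symmetric 2×2 real matrix with diagonal entries z²·E·(E + 1)/(E − 1)³ and y²·E·(E + 1)/(E − 1)³ and off-diagonal entries E·(y·z − E + y·z·E + 1)/(E − 1)³ is positive definite. -/
theorem stmt_4 (y z : ℝ) (hy : 0 < y) (hz : 0 < z) (E : ℝ)
    (hE : E = Real.exp (y * z)) :
    Matrix.PosDef
      !![z ^ 2 * E * (E + 1) / (E - 1) ^ 3,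
         E * (y * z - E + y * z * E + 1) / (E - 1) ^ 3;
         E * (y * z - E + y * z * E + 1) / (E - 1) ^ 3,
         y ^ 2 * E * (E + 1) / (E - 1) ^ 3] := by
  have ht : 0 < y * z := mul_pos hy hz
  have hE0 : 0 < E := hE ▸ Real.exp_pos _
  have hE1 : 0 < E - 1 := by
    have := Real.add_one_lt_exp ht.ne'
    rw [← hE] at this
    linarith
  have hE2 : E - 1 ≤ y * z * E := by
    have h1 := Real.add_one_le_exp (-(y * z))
    have h2 : E * Real.exp (-(y * z)) = 1 := by
      rw [hE, ← Real.exp_add]; simp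
    have h3 := mul_le_mul_of_nonneg_left h1 hE0.le
    rw [h2] at h3
    linarith
  have hc : 0 < E / (E - 1) ^ 3 := by positivity
  have hA : 0 < z ^ 2 * (E + 1) := by positivity
  have hD : 0 < (y * z * (E + 1)) ^ 2 - (y * z - E + y * z * E + 1) ^ 2 := by
    have : 0 < (E - 1) * (2 * (y * z * (E + 1)) - (E - 1)) := by
      apply mul_pos hE1
      nlinarith
    linarith
  apply Matrix.PosDef.of_dotProduct_mulVec_pos
  · ext i j
    fin_cases i <;> fin_cases j <;> simp
  · intro x hx
    have key : 0 < z ^ 2 * (E + 1) * x 0 ^ 2 + 2 * (y * z - E + y * z * E + 1) * x 0 * x 1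
        + y ^ 2 * (E + 1) * x 1 ^ 2 := by
      apply pos_of_mul_pos_right _ hA.le
      have e : z ^ 2 * (E + 1) * (z ^ 2 * (E + 1) * x 0 ^ 2
          + 2 * (y * z - E + y * z * E + 1) * x 0 * x 1 + y ^ 2 * (E + 1) * x 1 ^ 2)
        = (z ^ 2 * (E + 1) * x 0 + (y * z - E + y * z * E + 1) * x 1) ^ 2
          + ((y * z * (E + 1)) ^ 2 - (y * z - E + y * z * E + 1) ^ 2) * x 1 ^ 2 := by ring
      rw [e]
      by_cases h1 : x 1 = 0
      · have h0 : x 0 ≠ 0 := by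
          intro h0
          apply hx
          ext i
          fin_cases i <;> simp [h0, h1]
        rw [h1]
        have : 0 < (z ^ 2 * (E + 1) * x 0) ^ 2 := by positivity
        linarith
      · have : 0 < x 1 ^ 2 := by positivity
        have := mul_pos hD this
        positivity
    have := mul_pos hc key
    simp only [dotProduct, Matrix.mulVec, Fin.sum_univ_two, star_trivial, Pi.star_apply]
    simp
    convert this using 1
    ring
end

section
/- The function (x, y) ↦ 1/(x·y) is convex on the set {(x, y) ∈ ℝ² : x > 0 and y > 0}. -/
theorem aux_amgm_s5 (s t : ℝ) (hs : 0 < s) (ht : 0 < t) : 3 - s - t ≤ 1 / (s * t) := by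
  rw [le_div_iff₀ (mul_pos hs ht)]
  have hp : 0 < s * t := mul_pos hs ht
  rcases le_total 3 (s + t) with h | h
  · nlinarith
  · have h1 : (3 - s - t) * (s * t) ≤ (3 - s - t) * ((s + t) ^ 2 / 4) :=
      mul_le_mul_of_nonneg_left (by nlinarith [sq_nonneg (s - t)]) (by linarith)
    have h2 : 0 ≤ (s + t - 2) ^ 2 * (s + t + 1) := by positivity
    nlinarith

theorem aux_tangent (x y u v : ℝ) (hx : 0 < x) (hy : 0 < y) (hu : 0 < u) (hv : 0 < v) :
    1 / (u * v) * (3 - x / u - y / v) ≤ 1 / (x * y) := by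
  have h := mul_le_mul_of_nonneg_left (aux_amgm_s5 (x / u) (y / v) (by positivity) (by positivity))
    (show 0 ≤ 1 / (u * v) by positivity)
  refine h.trans (le_of_eq ?_)
  field_simp

theorem stmt_5 :
    ConvexOn ℝ {p : ℝ × ℝ | 0 < p.1 ∧ 0 < p.2}
      (fun p : ℝ × ℝ => 1 / (p.1 * p.2)) := by
  have hc : Convex ℝ {p : ℝ × ℝ | 0 < p.1 ∧ 0 < p.2} := by
    have := (convex_Ioi (𝕜 := ℝ) (0 : ℝ)).prod (convex_Ioi (𝕜 := ℝ) (0 : ℝ))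
    exact this
  refine ⟨hc, ?_⟩
  intro p hp q hq a b ha hb hab
  obtain ⟨hu, hv⟩ := hc hp hq ha hb hab
  obtain ⟨hp1, hp2⟩ := hp
  obtain ⟨hq1, hq2⟩ := hq
  simp only [Prod.fst_add, Prod.snd_add, Prod.smul_fst, Prod.smul_snd, smul_eq_mul] at hu hv ⊢
  obtain ⟨u, hu'⟩ : ∃ u, u = a * p.1 + b * q.1 := ⟨_, rfl⟩
  obtain ⟨v, hv'⟩ : ∃ v, v = a * p.2 + b * q.2 := ⟨_, rfl⟩
  rw [← hu'] at hu ⊢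
  rw [← hv'] at hv ⊢
  have h1 := mul_le_mul_of_nonneg_left (aux_tangent p.1 p.2 u v hp1 hp2 hu hv) ha
  have h2 := mul_le_mul_of_nonneg_left (aux_tangent q.1 q.2 u v hq1 hq2 hu hv) hb
  have e1 : a * (p.1 / u) + b * (q.1 / u) = 1 := by
    rw [← mul_div_assoc, ← mul_div_assoc, ← add_div, ← hu', div_self hu.ne']
  have e2 : a * (p.2 / v) + b * (q.2 / v) = 1 := by
    rw [← mul_div_assoc, ← mul_div_assoc, ← add_div, ← hv', div_self hv.ne']
  refine le_trans (le_of_eq ?_) (add_le_add h1 h2)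
  linear_combination (1 / (u * v)) * (e1 + e2 - 3 * hab)
end

section
/- For all f > 0 and R > 0 one has T̄²(f, R) ≥ T²(f, R), and moreover T̄²(f₀, R₀) = T²(f₀, R₀). -/
/-- The computation-time function of the second branch. -/
noncomputable def T2 (α β ρ τ D f R : ℝ) : ℝ :=
  (ρ * α * D - 4 * ρ * τ * f + 4 * β * τ * R) / (ρ * f + (α - β) * R) + 4 * τ

/-- The convex surrogate of `T2` built around the reference point `(f₀, R₀)`. -/
noncomputable def Tbar2 (α β ρ τ D f₀ R₀ f R : ℝ) : ℝ :=
  ρ * α * D / (ρ * f + (α - β) * R) + 4 * α * τ / (α - β) -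
    (4 * ρ * α * τ / (α - β)) * (f₀ / (ρ * f₀ + (α - β) * R₀)) *
      (3 - f₀ / f - (ρ * f + (α - β) * R) / (ρ * f₀ + (α - β) * R₀))

theorem amgm_aux (a b : ℝ) (ha : 0 < a) (hb : 0 < b) : 3 - 1 / a - b ≤ a / b := by
  obtain ⟨s, hs, rfl⟩ : ∃ s : ℝ, 0 < s ∧ b = s ^ 2 :=
    ⟨Real.sqrt b, Real.sqrt_pos.2 hb, (Real.sq_sqrt hb.le).symm⟩
  have key : a / s ^ 2 - (3 - 1 / a - s ^ 2) =
      ((a - s) ^ 2 + a * s * (s - 1) ^ 2 * (s + 2)) / (a * s ^ 2) := by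
    field_simp
    ring
  have : 0 ≤ ((a - s) ^ 2 + a * s * (s - 1) ^ 2 * (s + 2)) / (a * s ^ 2) := by positivity
  linarith

theorem T2_eq (α β ρ τ D f R : ℝ) (hαβ : β < α) (hS : 0 < ρ * f + (α - β) * R) :
    T2 α β ρ τ D f R = ρ * α * D / (ρ * f + (α - β) * R) + 4 * α * τ / (α - β) -
      (4 * ρ * α * τ / (α - β)) * (f / (ρ * f + (α - β) * R)) := by
  have h1 : α - β ≠ 0 := (sub_pos.2 hαβ).ne'
  have h2 := hS.ne'
  unfold T2
  generalize hSe : ρ * f + (α - β) * R = S at *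
  have hR : R = (S - ρ * f) / (α - β) := by
    rw [eq_div_iff h1]
    linarith
  rw [hR]
  field_simp
  ring

theorem stmt_8 (α β ρ τ D f₀ R₀ : ℝ)
    (hβ : 0 < β) (hαβ : β < α) (hρ0 : 0 < ρ) (hρ1 : ρ < 1)
    (hτ : 0 < τ) (hD : 0 < D) (hf₀ : 0 < f₀) (hR₀ : 0 < R₀) :
    (∀ f R : ℝ, 0 < f → 0 < R →
        Tbar2 α β ρ τ D f₀ R₀ f R ≥ T2 α β ρ τ D f R) ∧
      Tbar2 α β ρ τ D f₀ R₀ f₀ R₀ = T2 α β ρ τ D f₀ R₀ := by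
  have hd : 0 < α - β := sub_pos.2 hαβ
  have hα : 0 < α := hβ.trans hαβ
  have hS0 : 0 < ρ * f₀ + (α - β) * R₀ := by positivity
  constructor
  · intro f R hf hR
    have hS : 0 < ρ * f + (α - β) * R := by positivity
    rw [T2_eq α β ρ τ D f R hαβ hS]
    unfold Tbar2
    generalize ρ * f + (α - β) * R = S at *
    generalize ρ * f₀ + (α - β) * R₀ = S0 at *
    have h := amgm_aux (f / f₀) (S / S0) (by positivity) (by positivity)
    have h2 : f₀ / S0 * (3 - f₀ / f - S / S0) ≤ f / S := by
      have h3 := mul_le_mul_of_nonneg_left h (by positivity : 0 ≤ f₀ / S0)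
      have e1 : f₀ / S0 * (f / f₀ / (S / S0)) = f / S := by field_simp
      rw [e1, one_div_div] at h3
      exact h3
    have h4 := mul_le_mul_of_nonneg_left h2 (by positivity : 0 ≤ 4 * ρ * α * τ / (α - β))
    rw [mul_assoc]
    linarith
  · rw [T2_eq α β ρ τ D f₀ R₀ hαβ hS0]
    unfold Tbar2
    rw [div_self hf₀.ne', div_self hS0.ne']
    ring
end

section
/- For all f > 0 and R > 0 one has T̄³(f, R) ≥ T³(f, R), and moreover T̄³(f₀, R₀) = T³(f₀, R₀). -/
/-- The computation-time function of the third branch. -/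
noncomputable def T3 (α τ D f R : ℝ) : ℝ :=
  (α * D - 4 * τ * f) / (f + α * R) + 4 * τ

/-- The convex surrogate of `T3` built around the reference point `(f₀, R₀)`. -/
noncomputable def Tbar3 (α τ D f₀ R₀ f R : ℝ) : ℝ :=
  α * D / (f + α * R) + 4 * τ -
    (4 * τ * f₀ / (f₀ + α * R₀)) *
      (3 - f₀ / f - (f + α * R) / (f₀ + α * R₀))

lemma aux_poly (u v : ℝ) (hu : 0 < u) (hv : 0 < v) :
    0 ≤ u * v ^ 2 + (1 - 3 * u) * v + u ^ 2 := by
  rcases le_total u (1 / 4) with h | h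
  · have : 0 ≤ 1 - 3 * u := by linarith
    positivity
  · have h1 : 0 ≤ (u - 1) ^ 2 * (4 * u - 1) := mul_nonneg (sq_nonneg _) (by linarith)
    have h2 : 0 ≤ 4 * u * (u * v ^ 2 + (1 - 3 * u) * v + u ^ 2) := by
      nlinarith [sq_nonneg (2 * u * v + (1 - 3 * u))]
    exact nonneg_of_mul_nonneg_right h2 (by positivity)

lemma aux_main (f g s t : ℝ) (hf : 0 < f) (hg : 0 < g) (hs : 0 < s) (ht : 0 < t) :
    g / t * (3 - g / f - s / t) ≤ f / s := by
  have h := aux_poly (f / g) (s / t) (by positivity) (by positivity)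
  have e : f / s - g / t * (3 - g / f - s / t) =
      g ^ 2 / (f * s) * (f / g * (s / t) ^ 2 + (1 - 3 * (f / g)) * (s / t) + (f / g) ^ 2) := by
    field_simp
    ring
  have : 0 ≤ f / s - g / t * (3 - g / f - s / t) := by
    rw [e]; positivity
  linarith

theorem stmt_9 (α τ D f₀ R₀ : ℝ)
    (hα : 0 < α) (hτ : 0 < τ) (hD : 0 < D) (hf₀ : 0 < f₀) (hR₀ : 0 < R₀) :
    (∀ f R : ℝ, 0 < f → 0 < R →
        Tbar3 α τ D f₀ R₀ f R ≥ T3 α τ D f R) ∧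
      Tbar3 α τ D f₀ R₀ f₀ R₀ = T3 α τ D f₀ R₀ := by
  constructor
  · intro f R hf hR
    have h := aux_main f f₀ (f + α * R) (f₀ + α * R₀) hf hf₀ (by positivity) (by positivity)
    have h2 := mul_le_mul_of_nonneg_left h (by positivity : 0 ≤ 4 * τ)
    unfold Tbar3 T3
    have e1 : (α * D - 4 * τ * f) / (f + α * R)
        = α * D / (f + α * R) - 4 * τ * (f / (f + α * R)) := by ring
    have e2 : 4 * τ * f₀ / (f₀ + α * R₀) * (3 - f₀ / f - (f + α * R) / (f₀ + α * R₀))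
        = 4 * τ * (f₀ / (f₀ + α * R₀) * (3 - f₀ / f - (f + α * R) / (f₀ + α * R₀))) := by ring
    rw [e1, e2]
    linarith
  · have h : f₀ + α * R₀ ≠ 0 := by positivity
    unfold Tbar3 T3
    rw [div_self h, div_self hf₀.ne']
    ring
end

section
/- The surrogate functions (f, R) ↦ T̄²(f, R) and (f, R) ↦ T̄³(f, R) are each convex on the set {(f, R) ∈ ℝ² : f > 0 and R > 0}. -/
theorem aux_inv (x y s t : ℝ) (hx : 0 < x) (hy : 0 < y) (hs : 0 ≤ s) (ht : 0 ≤ t)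
    (hst : s + t = 1) : (s * x + t * y)⁻¹ ≤ s * x⁻¹ + t * y⁻¹ := by
  have h := (convexOn_zpow (𝕜 := ℝ) (-1)).2 (Set.mem_Ioi.2 hx) (Set.mem_Ioi.2 hy) hs ht hst
  simpa using h

theorem aux_gen (a b A B c d e : ℝ) (ha : 0 < a) (hb : 0 < b) (hA : 0 ≤ A) (hB : 0 ≤ B) :
    ConvexOn ℝ {p : ℝ × ℝ | 0 < p.1 ∧ 0 < p.2}
      (fun p : ℝ × ℝ => A * (a * p.1 + b * p.2)⁻¹ + B * p.1⁻¹ + c * p.1 + d * p.2 + e) := by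
  constructor
  · rintro ⟨x, y⟩ ⟨hx, hy⟩ ⟨z, w⟩ ⟨hz, hw⟩ s t hs ht hst
    exact ⟨convex_Ioi (𝕜 := ℝ) (0 : ℝ) hx hz hs ht hst, convex_Ioi (𝕜 := ℝ) (0 : ℝ) hy hw hs ht hst⟩
  · rintro ⟨x, y⟩ ⟨hx, hy⟩ ⟨z, w⟩ ⟨hz, hw⟩ s t hs ht hst
    simp only at hx hy hz hw
    simp only [Prod.smul_mk, Prod.mk_add_mk, smul_eq_mul]
    have h1 := mul_le_mul_of_nonneg_left (aux_inv x z s t hx hz hs ht hst) hB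
    have h2 := mul_le_mul_of_nonneg_left (aux_inv (a * x + b * y) (a * z + b * w) s t
      (by positivity) (by positivity) hs ht hst) hA
    have e1 : a * (s * x + t * z) + b * (s * y + t * w)
      = s * (a * x + b * y) + t * (a * z + b * w) := by ring
    rw [e1]
    have e2 : e = s * e + t * e := by rw [← add_mul, hst, one_mul]
    linarith

theorem stmt_10 (α β ρ τ D f₀ R₀ : ℝ)
    (hβ : 0 < β) (hαβ : β < α) (hρ0 : 0 < ρ) (hρ1 : ρ < 1)
    (hτ : 0 < τ) (hD : 0 < D) (hf₀ : 0 < f₀) (hR₀ : 0 < R₀) :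
    ConvexOn ℝ {p : ℝ × ℝ | 0 < p.1 ∧ 0 < p.2}
        (fun p : ℝ × ℝ => Tbar2 α β ρ τ D f₀ R₀ p.1 p.2) ∧
      ConvexOn ℝ {p : ℝ × ℝ | 0 < p.1 ∧ 0 < p.2}
        (fun p : ℝ × ℝ => Tbar3 α τ D f₀ R₀ p.1 p.2) := by
  have hab : 0 < α - β := sub_pos.2 hαβ
  have hα : 0 < α := hβ.trans hαβ
  constructor
  · have hN : 0 < ρ * f₀ + (α - β) * R₀ := by positivity
    set N := ρ * f₀ + (α - β) * R₀ with hNd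
    set K := (4 * ρ * α * τ / (α - β)) * (f₀ / N) with hK
    have hK0 : 0 ≤ K := by positivity
    convert aux_gen ρ (α - β) (ρ * α * D) (K * f₀) (K * ρ / N) (K * (α - β) / N)
      (4 * α * τ / (α - β) - 3 * K) hρ0 hab (by positivity) (by positivity) using 2 with p
    simp only [Tbar2]
    rw [← hNd, ← hK]
    ring
  · have hN : 0 < f₀ + α * R₀ := by positivity
    set N := f₀ + α * R₀ with hNd
    set K := 4 * τ * f₀ / N with hK
    have hK0 : 0 ≤ K := by positivity
    convert aux_gen 1 α (α * D) (K * f₀) (K / N) (K * α / N)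
      (4 * τ - 3 * K) one_pos hα (by positivity) (by positivity) using 2 with p
    simp only [Tbar3]
    rw [← hNd, ← hK, one_mul]
    ring
end

section
/- The function (f, R) ↦ max{T¹(f, R), T̄²(f, R)} is convex on the set {(f, R) ∈ ℝ² : f > 0 and R > 0}. -/
/-- The computation-time function of the first branch. -/
noncomputable def T1 (β ρ τ D f R : ℝ) : ℝ :=
  β * D / (β * R + (1 - ρ) * f) + 4 * τ

lemma quad_convex : Convex ℝ {p : ℝ × ℝ | 0 < p.1 ∧ 0 < p.2} := by
  have : {p : ℝ × ℝ | 0 < p.1 ∧ 0 < p.2} = Set.Ioi (0:ℝ) ×ˢ Set.Ioi (0:ℝ) := by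
    ext p; simp
  rw [this]
  exact (convex_Ioi 0).prod (convex_Ioi 0)

lemma inv_lin_convex (a b c : ℝ) (ha : 0 < a) (hb : 0 ≤ b) (hc : 0 ≤ c) :
    ConvexOn ℝ {p : ℝ × ℝ | 0 < p.1 ∧ 0 < p.2}
      (fun p : ℝ × ℝ => c / (a * p.1 + b * p.2)) := by
  refine ⟨quad_convex, ?_⟩
  rintro ⟨x1, x2⟩ ⟨hx1, hx2⟩ ⟨y1, y2⟩ ⟨hy1, hy2⟩ s t hs ht hst
  simp only at hx1 hx2 hy1 hy2
  have hX : 0 < a * x1 + b * x2 := by positivity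
  have hY : 0 < a * y1 + b * y2 := by positivity
  have h := (convexOn_zpow (𝕜 := ℝ) (-1)).2 (Set.mem_Ioi.2 hX) (Set.mem_Ioi.2 hY) hs ht hst
  simp only [smul_eq_mul, zpow_neg_one] at h
  have h2 := mul_le_mul_of_nonneg_left h hc
  simp only [smul_eq_mul, Prod.fst_add, Prod.snd_add, Prod.smul_fst, Prod.smul_snd, div_eq_mul_inv]
  have e : a * (s * x1 + t * y1) + b * (s * x2 + t * y2)
      = s * (a * x1 + b * x2) + t * (a * y1 + b * y2) := by ring
  rw [e]
  linarith

lemma aff_convex (a b c : ℝ) :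
    ConvexOn ℝ {p : ℝ × ℝ | 0 < p.1 ∧ 0 < p.2}
      (fun p : ℝ × ℝ => a * p.1 + b * p.2 + c) := by
  refine ⟨quad_convex, ?_⟩
  rintro ⟨x1, x2⟩ - ⟨y1, y2⟩ - s t hs ht hst
  obtain rfl : t = 1 - s := by linarith
  simp only [smul_eq_mul, Prod.fst_add, Prod.snd_add, Prod.smul_fst, Prod.smul_snd]
  apply le_of_eq
  ring

theorem stmt_11 (α β ρ τ D f₀ R₀ : ℝ)
    (hβ : 0 < β) (hαβ : β < α) (hρ0 : 0 < ρ) (hρ1 : ρ < 1)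
    (hτ : 0 < τ) (hD : 0 < D) (hf₀ : 0 < f₀) (hR₀ : 0 < R₀) :
    ConvexOn ℝ {p : ℝ × ℝ | 0 < p.1 ∧ 0 < p.2}
      (fun p : ℝ × ℝ =>
        max (T1 β ρ τ D p.1 p.2) (Tbar2 α β ρ τ D f₀ R₀ p.1 p.2)) := by
  have hd : 0 < α - β := sub_pos.2 hαβ
  have hr : 0 < 1 - ρ := sub_pos.2 hρ1
  have hα : 0 < α := hβ.trans hαβ
  have hN : 0 < ρ * f₀ + (α - β) * R₀ := by positivity
  refine ConvexOn.sup (f := fun p : ℝ × ℝ => T1 β ρ τ D p.1 p.2)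
    (g := fun p : ℝ × ℝ => Tbar2 α β ρ τ D f₀ R₀ p.1 p.2) ?_ ?_
  · refine ((inv_lin_convex (1 - ρ) β (β * D) hr hβ.le (by positivity)).add
      (aff_convex 0 0 (4 * τ))).congr ?_
    intro p _
    simp only [T1, Pi.add_apply]
    rw [add_comm (β * p.2)]
    ring
  · obtain ⟨K, hK⟩ : ∃ K, K = (4 * ρ * α * τ / (α - β)) * (f₀ / (ρ * f₀ + (α - β) * R₀)) :=
      ⟨_, rfl⟩
    have hK0 : 0 < K := by rw [hK]; positivity
    refine (((inv_lin_convex ρ (α - β) (ρ * α * D) hρ0 hd.le (by positivity)).add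
      (inv_lin_convex 1 0 (K * f₀) one_pos le_rfl (by positivity))).add
      (aff_convex (K * ρ / (ρ * f₀ + (α - β) * R₀)) (K * (α - β) / (ρ * f₀ + (α - β) * R₀))
        (4 * α * τ / (α - β) - 3 * K))).congr ?_
    intro p _
    simp only [Tbar2, Pi.add_apply, ← hK, one_mul, zero_mul, add_zero]
    generalize ρ * f₀ + (α - β) * R₀ = N
    generalize ρ * α * D / (ρ * p.1 + (α - β) * p.2) = A
    generalize 4 * α * τ / (α - β) = B
    ring
end

section
/- Suppose f > 0 and R > 0 satisfy ρ·f ≤ β·R and 4(1−ρ)τ·f + 4βτ·R ≤ (α − αρ − β)·D. Then T²(f, R) ≤ T¹(f, R) ≤ T³(f, R) ≤ T⁴(f, R). -/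
/-- Fourth candidate computation time. -/
noncomputable def T4 (α D f : ℝ) : ℝ := α * D / f

theorem stmt_12 (α β ρ τ D f R : ℝ)
    (hβ : 0 < β) (hαβ : β < α) (hρ0 : 0 < ρ) (hρ1 : ρ < 1)
    (hτ : 0 < τ) (hD : 0 < D) (hf : 0 < f) (hR : 0 < R)
    (h1 : ρ * f ≤ β * R)
    (h2 : 4 * (1 - ρ) * τ * f + 4 * β * τ * R ≤ (α - α * ρ - β) * D) :
    T2 α β ρ τ D f R ≤ T1 β ρ τ D f R ∧
      T1 β ρ τ D f R ≤ T3 α τ D f R ∧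
        T3 α τ D f R ≤ T4 α D f := by
  have hρ : 0 < 1 - ρ := by linarith
  have hα : 0 < α := by linarith
  have hd1 : 0 < β * R + (1 - ρ) * f := by positivity
  have hd2 : 0 < ρ * f + (α - β) * R := by
    have : 0 < α - β := by linarith
    positivity
  have hd3 : 0 < f + α * R := by positivity
  have hs : 0 ≤ (α - α * ρ - β) * D - (4 * (1 - ρ) * τ * f + 4 * β * τ * R) := by linarith
  have h4 : 4 * τ * f ≤ α * D := by
    have e1 : 0 < β * D := by positivity
    have e2 : 0 < β * τ * R := by positivity
    have : (1 - ρ) * (4 * τ * f) ≤ (1 - ρ) * (α * D) := by linarith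
    exact le_of_mul_le_mul_left this hρ
  unfold T1 T2 T3 T4
  refine ⟨?_, ?_, ?_⟩
  · apply add_le_add_left
    rw [div_le_div_iff₀ hd2 hd1]
    linarith [mul_nonneg (sub_nonneg.2 h1) hs]
  · apply add_le_add_left
    rw [div_le_div_iff₀ hd1 hd3]
    linarith [mul_nonneg hf.le hs]
  · rw [div_add' _ _ _ hd3.ne', div_le_div_iff₀ hd3 hf]
    have e : 0 ≤ α * R * (α * D - 4 * τ * f) := by
      have : 0 ≤ α * D - 4 * τ * f := by linarith
      positivity
    linarith
end

section
/- Suppose f > 0 and R > 0 satisfy β·R ≤ ρ·f and 4(1−ρ)τ·f + 4βτ·R ≤ (α − αρ − β)·D. Then T¹(f, R) ≤ T²(f, R) ≤ T³(f, R) ≤ T⁴(f, R). -/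
theorem stmt_13 (α β ρ τ D f R : ℝ)
    (hβ : 0 < β) (hαβ : β < α) (hρ0 : 0 < ρ) (hρ1 : ρ < 1)
    (hτ : 0 < τ) (hD : 0 < D) (hf : 0 < f) (hR : 0 < R)
    (h1 : β * R ≤ ρ * f)
    (h2 : 4 * (1 - ρ) * τ * f + 4 * β * τ * R ≤ (α - α * ρ - β) * D) :
    T1 β ρ τ D f R ≤ T2 α β ρ τ D f R ∧
      T2 α β ρ τ D f R ≤ T3 α τ D f R ∧
        T3 α τ D f R ≤ T4 α D f := by
  have hα : 0 < α := hβ.trans hαβ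
  have hr : 0 < 1 - ρ := by linarith
  have hab : 0 < α - β := by linarith
  have hB1 : 0 < β * R + (1 - ρ) * f := by positivity
  have hB2 : 0 < ρ * f + (α - β) * R := by positivity
  have hB3 : 0 < f + α * R := by positivity
  have hk : 0 ≤ (α - α * ρ - β) * D - (4 * (1 - ρ) * τ * f + 4 * β * τ * R) := by linarith
  have hx : 0 ≤ ρ * f - β * R := by linarith
  have e1 := mul_nonneg hx hk
  have e2 := mul_nonneg (mul_pos hα hR).le hk
  have h4 : 0 ≤ α * D - 4 * τ * f := by
    have a1 : 0 < β * τ * R := by positivity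
    have a2 : 0 < β * D := by positivity
    have : 0 ≤ (1 - ρ) * (α * D - 4 * τ * f) := by linarith
    exact nonneg_of_mul_nonneg_right this hr
  have e3 := mul_nonneg (mul_pos hα hR).le h4
  unfold T1 T2 T3 T4
  refine ⟨?_, ?_, ?_⟩
  · gcongr ?_ + _
    rw [div_le_div_iff₀ hB1 hB2]
    linarith
  · gcongr ?_ + _
    rw [div_le_div_iff₀ hB2 hB3]
    linarith
  · rw [div_add' _ _ _ hB3.ne', div_le_div_iff₀ hB3 hf]
    linarith
end

section
/- Suppose f > 0 and R > 0 satisfy 4(1−ρ)τ·f + 4βτ·R ≥ (α − αρ − β)·D and 4τ·f ≤ α·D. Then T³(f, R) ≤ T¹(f, R), T³(f, R) ≤ T²(f, R), and T³(f, R) ≤ T⁴(f, R). -/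
theorem stmt_14 (α β ρ τ D f R : ℝ)
    (hβ : 0 < β) (hαβ : β < α) (hρ0 : 0 < ρ) (hρ1 : ρ < 1)
    (hτ : 0 < τ) (hD : 0 < D) (hf : 0 < f) (hR : 0 < R)
    (h1 : (α - α * ρ - β) * D ≤ 4 * (1 - ρ) * τ * f + 4 * β * τ * R)
    (h2 : 4 * τ * f ≤ α * D) :
    T3 α τ D f R ≤ T1 β ρ τ D f R ∧
      T3 α τ D f R ≤ T2 α β ρ τ D f R ∧
        T3 α τ D f R ≤ T4 α D f := by
  have hα : 0 < α := hβ.trans hαβ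
  have hd1 : 0 < β * R + (1 - ρ) * f := by
    have := mul_pos (sub_pos.2 hρ1) hf
    positivity
  have hd2 : 0 < ρ * f + (α - β) * R := by
    have := mul_pos (sub_pos.2 hαβ) hR
    positivity
  have hd3 : 0 < f + α * R := by positivity
  have h1' := sub_nonneg.2 h1
  refine ⟨?_, ?_, ?_⟩
  · unfold T3 T1
    gcongr ?_ + _
    rw [div_le_div_iff₀ hd3 hd1]
    linarith [mul_nonneg hf.le h1']
  · unfold T3 T2
    gcongr ?_ + _
    rw [div_le_div_iff₀ hd3 hd2]
    linarith [mul_nonneg (mul_pos hR hα).le h1']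
  · unfold T3 T4
    rw [div_add' _ _ _ hd3.ne', div_le_div_iff₀ hd3 hf]
    linarith [mul_nonneg (mul_pos hR hα).le (sub_nonneg.2 h2)]
end

section
/- Suppose f > 0 and R > 0 satisfy 4τ·f ≥ α·D. Then T⁴(f, R) ≤ T³(f, R) ≤ T²(f, R). -/
theorem stmt_15 (α β ρ τ D f R : ℝ)
    (hβ : 0 < β) (hαβ : β < α) (hρ0 : 0 < ρ) (hρ1 : ρ < 1)
    (hτ : 0 < τ) (hD : 0 < D) (hf : 0 < f) (hR : 0 < R)
    (h : α * D ≤ 4 * τ * f) :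
    T4 α D f ≤ T3 α τ D f R ∧ T3 α τ D f R ≤ T2 α β ρ τ D f R := by
  have hα : 0 < α := hβ.trans hαβ
  have hαR : 0 < α * R := mul_pos hα hR
  have hd3 : 0 < f + α * R := by linarith
  have hd2 : 0 < ρ * f + (α - β) * R :=
    add_pos (mul_pos hρ0 hf) (mul_pos (sub_pos.2 hαβ) hR)
  unfold T4 T3 T2
  constructor
  · have e : α * D / f = (α * D - 4 * τ * f) / f + 4 * τ := by field_simp; ring
    rw [e]
    have : (α * D - 4 * τ * f) / f ≤ (α * D - 4 * τ * f) / (f + α * R) := by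
      rw [div_le_div_iff₀ hf hd3]
      have := mul_nonneg (sub_nonneg.2 h) hαR.le
      nlinarith
    linarith
  · have : (α * D - 4 * τ * f) / (f + α * R) ≤
        (ρ * α * D - 4 * ρ * τ * f + 4 * β * τ * R) / (ρ * f + (α - β) * R) := by
      rw [div_le_div_iff₀ hd3 hd2]
      have h1 : 0 ≤ (4 * τ * f - α * D) * ((1 - ρ) * α) * R :=
        mul_nonneg (mul_nonneg (sub_nonneg.2 h)
          (mul_nonneg (sub_nonneg.2 hρ1.le) hα.le)) hR.le
      have h2 : 0 ≤ α * D * β * R := by positivity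
      have h3 : 0 ≤ 4 * β * τ * (α * R) * R := by positivity
      linarith
    linarith
end

section
/- Let F(x) = (αβD − 4βτf + 4βτx)/((α − αρ − β)x + βf + αβR) + 4τ and let S = {x ∈ ℝ : x ≥ 0 and (α − αρ − β)x + βf + αβR > 0}. If 4(1−ρ)τ·f + 4βτ·R ≥ (α − αρ − β)·D, then F is monotone nondecreasing on S; if 4(1−ρ)τ·f + 4βτ·R ≤ (α − αρ − β)·D, then F is monotone nonincreasing on S. -/
theorem stmt_16 (α β ρ τ D f R : ℝ)
    (hβ : 0 < β) (hαβ : β < α) (hρ0 : 0 < ρ) (hρ1 : ρ < 1)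
    (hτ : 0 < τ) (hD : 0 < D) (hf : 0 < f) (hR : 0 ≤ R)
    (F : ℝ → ℝ)
    (hF : ∀ x : ℝ, F x =
      (α * β * D - 4 * β * τ * f + 4 * β * τ * x) /
          ((α - α * ρ - β) * x + β * f + α * β * R) + 4 * τ)
    (S : Set ℝ)
    (hS : S = {x : ℝ | 0 ≤ x ∧ 0 < (α - α * ρ - β) * x + β * f + α * β * R}) :
    ((α - α * ρ - β) * D ≤ 4 * (1 - ρ) * τ * f + 4 * β * τ * R →
        MonotoneOn F S) ∧
      (4 * (1 - ρ) * τ * f + 4 * β * τ * R ≤ (α - α * ρ - β) * D →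
        AntitoneOn F S) := by
  have hα : 0 < α := hβ.trans hαβ
  have hab : 0 < α * β := mul_pos hα hβ
  subst hS
  constructor
  · intro h x hx y hy hxy
    rw [hF, hF]
    have key := mul_nonneg (mul_nonneg hab.le (sub_nonneg.2 h)) (sub_nonneg.2 hxy)
    have := (div_le_div_iff₀ hx.2 hy.2).2 (show
      (α * β * D - 4 * β * τ * f + 4 * β * τ * x) *
          ((α - α * ρ - β) * y + β * f + α * β * R) ≤
        (α * β * D - 4 * β * τ * f + 4 * β * τ * y) *
          ((α - α * ρ - β) * x + β * f + α * β * R) by linarith)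
    linarith
  · intro h x hx y hy hxy
    rw [hF, hF]
    have key := mul_nonneg (mul_nonneg hab.le (sub_nonneg.2 h)) (sub_nonneg.2 hxy)
    have := (div_le_div_iff₀ hy.2 hx.2).2 (show
      (α * β * D - 4 * β * τ * f + 4 * β * τ * y) *
          ((α - α * ρ - β) * x + β * f + α * β * R) ≤
        (α * β * D - 4 * β * τ * f + 4 * β * τ * x) *
          ((α - α * ρ - β) * y + β * f + α * β * R) by linarith)
    linarith
end

section
/- Let a₁, a₂, a₃ > 0, c ≥ 0 and D > 0 be reals with a₁·D ≥ c, and set T* = (D + c/a₂ + c/a₃)/(1/a₁ + 1/a₂ + 1/a₃). Then: (i) for all D₁, D₂, D₃ ≥ 0 with D₁ + D₂ + D₃ = D, max{a₁·D₁, (if D₂ > 0 then a₂·D₂ + c else 0), (if D₃ > 0 then a₃·D₃ + c else 0)} ≥ T*; and (ii) the choice D₁ = T*/a₁, D₂ = (T* − c)/a₂, D₃ = (T* − c)/a₃ is feasible (nonnegative with sum D) and attains the value T*. -/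
theorem stmt_17 (a₁ a₂ a₃ c D : ℝ)
    (ha₁ : 0 < a₁) (ha₂ : 0 < a₂) (ha₃ : 0 < a₃) (hc : 0 ≤ c) (hD : 0 < D)
    (h : c ≤ a₁ * D)
    (Tstar : ℝ)
    (hT : Tstar = (D + c / a₂ + c / a₃) / (1 / a₁ + 1 / a₂ + 1 / a₃)) :
    (∀ D₁ D₂ D₃ : ℝ, 0 ≤ D₁ → 0 ≤ D₂ → 0 ≤ D₃ → D₁ + D₂ + D₃ = D →
        Tstar ≤ max (a₁ * D₁)
          (max (if 0 < D₂ then a₂ * D₂ + c else 0)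
            (if 0 < D₃ then a₃ * D₃ + c else 0))) ∧
      (0 ≤ Tstar / a₁ ∧ 0 ≤ (Tstar - c) / a₂ ∧ 0 ≤ (Tstar - c) / a₃ ∧
        Tstar / a₁ + (Tstar - c) / a₂ + (Tstar - c) / a₃ = D ∧
        max (a₁ * (Tstar / a₁))
          (max (if 0 < (Tstar - c) / a₂ then a₂ * ((Tstar - c) / a₂) + c else 0)
            (if 0 < (Tstar - c) / a₃ then a₃ * ((Tstar - c) / a₃) + c else 0))
          = Tstar) := by
  have hS : 0 < 1 / a₁ + 1 / a₂ + 1 / a₃ := by positivity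
  have hTS : Tstar * (1 / a₁ + 1 / a₂ + 1 / a₃) = D + c / a₂ + c / a₃ := by
    rw [hT]; exact div_mul_cancel₀ _ hS.ne'
  have hsum : Tstar / a₁ + (Tstar - c) / a₂ + (Tstar - c) / a₃ = D := by
    have e : Tstar / a₁ + (Tstar - c) / a₂ + (Tstar - c) / a₃
        = Tstar * (1 / a₁ + 1 / a₂ + 1 / a₃) - c / a₂ - c / a₃ := by ring
    rw [e, hTS]; ring
  have hcT : c ≤ Tstar := by
    have h1 : c / a₁ ≤ D := by
      rw [div_le_iff₀ ha₁]; linarith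
    have h2 : c * (1 / a₁ + 1 / a₂ + 1 / a₃) ≤ Tstar * (1 / a₁ + 1 / a₂ + 1 / a₃) := by
      have e : c * (1 / a₁ + 1 / a₂ + 1 / a₃) = c / a₁ + c / a₂ + c / a₃ := by ring
      rw [hTS, e]; linarith
    exact le_of_mul_le_mul_right h2 hS
  have hT0 : 0 ≤ Tstar := hc.trans hcT
  have hd : 0 ≤ Tstar - c := by linarith
  have key : ∀ a x : ℝ, 0 < a → 0 ≤ x → (if 0 < x then a * x + c else 0) < Tstar →
      x ≤ (Tstar - c) / a := by
    intro a x ha hx hlt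
    rw [le_div_iff₀ ha]
    split_ifs at hlt with h0
    · linarith
    · have : x = 0 := by linarith
      subst this; linarith
  have key2 : ∀ a : ℝ, 0 < a →
      (if 0 < (Tstar - c) / a then a * ((Tstar - c) / a) + c else 0) ≤ Tstar := by
    intro a ha
    rw [show a * ((Tstar - c) / a) = Tstar - c by field_simp]
    split_ifs <;> linarith
  refine ⟨?_, by positivity, by positivity, by positivity, hsum, ?_⟩
  · intro D₁ D₂ D₃ h1 h2 h3 hs
    by_contra hlt
    rw [not_le, max_lt_iff, max_lt_iff] at hlt
    obtain ⟨l1, l2, l3⟩ := hlt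
    have k1 : D₁ < Tstar / a₁ := by
      rw [lt_div_iff₀ ha₁]; linarith
    have k2 := key a₂ D₂ ha₂ h2 l2
    have k3 := key a₃ D₃ ha₃ h3 l3
    linarith
  · rw [show a₁ * (Tstar / a₁) = Tstar by field_simp]
    exact max_eq_left (max_le (key2 a₂ ha₂) (key2 a₃ ha₃))
end

section
/- Let h ≥ 0, n ≥ 0, c > 0 and m ∈ ℝ be reals. The function (l, T) ↦ (h + (n/2)·log(1 + c/(l − m))/log 2)/T is convex on the set {(l, T) ∈ ℝ² : l > m and T > 0}. -/
lemma aux_logf (c : ℝ) (hc : 0 < c) :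
    ConvexOn ℝ (Set.Ioi (0:ℝ)) (fun x => Real.log (Real.log (x + c) - Real.log x)) := by
  have hf : ∀ x : ℝ, 0 < x → c / (x + c) ≤ Real.log (x + c) - Real.log x := by
    intro x hx
    have h1 := Real.log_le_sub_one_of_pos (show 0 < x / (x + c) by positivity)
    rw [Real.log_div hx.ne' (by positivity)] at h1
    have : x / (x + c) - 1 = - (c / (x + c)) := by field_simp; ring
    linarith
  have hfp : ∀ x : ℝ, 0 < x → 0 < Real.log (x + c) - Real.log x := by
    intro x hx
    exact lt_of_lt_of_le (by positivity) (hf x hx)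
  have hd : ∀ x : ℝ, 0 < x →
      HasDerivAt (fun x => Real.log (x + c) - Real.log x) (1 / (x + c) - x⁻¹) x := by
    intro x hx
    exact (((hasDerivAt_id x).add_const c).log (by simp; positivity)).sub
      (Real.hasDerivAt_log hx.ne')
  have hd2 : ∀ x : ℝ, 0 < x →
      HasDerivAt (fun x => 1 / (x + c) - x⁻¹) (-1 / (x + c) ^ 2 - -(x ^ 2)⁻¹) x := by
    intro x hx
    have := (((hasDerivAt_id x).add_const c).inv (by simp; positivity)).sub
      (hasDerivAt_inv hx.ne')
    simpa [one_div, Pi.sub_def, Pi.inv_def] using this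
  apply convexOn_of_hasDerivWithinAt2_nonneg (convex_Ioi 0)
    (f' := fun x => (1 / (x + c) - x⁻¹) / (Real.log (x + c) - Real.log x))
    (f'' := fun x => ((-1 / (x + c) ^ 2 - -(x ^ 2)⁻¹) * (Real.log (x + c) - Real.log x)
      - (1 / (x + c) - x⁻¹) * (1 / (x + c) - x⁻¹)) / (Real.log (x + c) - Real.log x) ^ 2)
  · intro x hx
    exact ((hd x hx).log (hfp x hx).ne').continuousAt.continuousWithinAt
  · intro x hx
    rw [interior_Ioi] at hx
    exact ((hd x hx).log (hfp x hx).ne').hasDerivWithinAt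
  · intro x hx
    rw [interior_Ioi] at hx
    exact ((hd2 x hx).div (hd x hx) (hfp x hx).ne').hasDerivWithinAt
  · intro x hx
    rw [interior_Ioi] at hx
    have hx : 0 < x := hx
    apply div_nonneg _ (by positivity)
    have e : -1 / (x + c) ^ 2 - -(x ^ 2)⁻¹ = c * (2 * x + c) / (x ^ 2 * (x + c) ^ 2) := by
      field_simp; ring
    have e2 : (1 / (x + c) - x⁻¹) * (1 / (x + c) - x⁻¹)
        = c * (2 * x + c) / (x ^ 2 * (x + c) ^ 2) * (c / (2 * x + c)) := by
      field_simp; ring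
    rw [e2, e, ← mul_sub]
    apply mul_nonneg (by positivity)
    have : c / (2 * x + c) ≤ c / (x + c) := by gcongr; linarith
    linarith [hf x hx]

lemma aux_exp {s : Set (ℝ × ℝ)} {g : ℝ × ℝ → ℝ} (hg : ConvexOn ℝ s g) :
    ConvexOn ℝ s (fun p => Real.exp (g p)) := by
  refine ⟨hg.1, fun x hx y hy a b ha hb hab => ?_⟩
  exact (Real.exp_le_exp.2 (hg.2 hx hy ha hb hab)).trans
    (convexOn_exp.2 (Set.mem_univ _) (Set.mem_univ _) ha hb hab)

theorem stmt_19 (h n c m : ℝ) (hh : 0 ≤ h) (hn : 0 ≤ n) (hc : 0 < c) :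
    ConvexOn ℝ {p : ℝ × ℝ | m < p.1 ∧ 0 < p.2}
      (fun p : ℝ × ℝ =>
        (h + (n / 2) * Real.log (1 + c / (p.1 - m)) / Real.log 2) / p.2) := by
  have hs : Convex ℝ {p : ℝ × ℝ | m < p.1 ∧ 0 < p.2} :=
    ((convex_Ioi m).prod (convex_Ioi (0:ℝ)))
  have hT : ConvexOn ℝ {p : ℝ × ℝ | m < p.1 ∧ 0 < p.2} (fun p => -Real.log p.2) := by
    refine ⟨hs, fun x hx y hy a b ha hb hab => ?_⟩
    have := strictConcaveOn_log_Ioi.concaveOn.neg.2 hx.2 hy.2 ha hb hab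
    simpa using this
  have hF : ConvexOn ℝ {p : ℝ × ℝ | m < p.1 ∧ 0 < p.2}
      (fun p => Real.log (Real.log ((p.1 - m) + c) - Real.log (p.1 - m))) := by
    refine ⟨hs, fun x hx y hy a b ha hb hab => ?_⟩
    have := (aux_logf c hc).2 (x := x.1 - m) (sub_pos.2 hx.1) (y := y.1 - m) (sub_pos.2 hy.1)
      ha hb hab
    have e : a • (x.1 - m) + b • (y.1 - m) = (a • x + b • y).1 - m := by
      simp only [smul_eq_mul, Prod.fst_add, Prod.smul_fst]
      linear_combination (-m) * hab
    rw [e] at this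
    exact this
  have hl2 : 0 < Real.log 2 := Real.log_pos (by norm_num)
  have h1 := ((aux_exp hT).smul hh).add
    ((aux_exp (hF.add hT)).smul (show 0 ≤ n / 2 / Real.log 2 by positivity))
  refine h1.congr ?_
  rintro ⟨l, T⟩ ⟨hl, hT0⟩
  have hl : 0 < l - m := sub_pos.2 hl
  have hT0 : 0 < T := hT0
  have e : Real.log (1 + c / (l - m)) = Real.log ((l - m) + c) - Real.log (l - m) := by
    rw [← Real.log_div (by positivity) hl.ne']
    congr 1
    field_simp
  have hp : 0 < Real.log ((l - m) + c) - Real.log (l - m) :=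
    sub_pos.2 (Real.log_lt_log hl (by linarith))
  simp only [Pi.add_apply, smul_eq_mul]
  rw [e, Real.exp_add, Real.exp_neg, Real.exp_log hT0, Real.exp_log hp]
  field_simp
end
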